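/- arXiv:2602.13956 — 2 statements merged into one kernel-verified Lean document; each statement's English description precedes it below -/
import Mathlib

section
/- Let T be a balanced tree of height at least 4. Then T is not well-totally dominated. -/
open SimpleGraph Set

/-- Open neighborhood of a set of vertices. -/
def nbhd {V : Type*} (G : SimpleGraph V) (D : Set V) : Set V :=
  {u | ∃ v ∈ D, G.Adj v u}

/-- Total dominating set. -/
def IsTDS {V : Type*} (G : SimpleGraph V) (D : Set V) : Prop :=
  nbhd G D = Set.univ

/-- Minimal total dominating set. -/
def IsMinTDS {V : Type*} (G : SimpleGraph V) (D : Set V) : Prop :=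
  IsTDS G D ∧ ∀ D' : Set V, D' ⊂ D → ¬ IsTDS G D'

/-- Well-totally dominated graph: all minimal TDSs have the same size. -/
def WTD {V : Type*} (G : SimpleGraph V) : Prop :=
  ∀ D₁ D₂ : Set V, IsMinTDS G D₁ → IsMinTDS G D₂ → D₁.ncard = D₂.ncard

/-- A leaf is a vertex of degree 1. -/
def IsLeaf {V : Type*} (G : SimpleGraph V) (v : V) : Prop :=
  (G.neighborSet v).ncard = 1

/-- Height of a vertex: minimum distance to a leaf. -/
noncomputable def heightV {V : Type*} (G : SimpleGraph V) (v : V) : ℕ :=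
  sInf {d | ∃ ℓ, IsLeaf G ℓ ∧ G.dist v ℓ = d}

/-- Height of a graph: maximum vertex height. -/
noncomputable def heightG {V : Type*} (G : SimpleGraph V) : ℕ :=
  sSup {d | ∃ v, heightV G v = d}

/-- Balanced: no two vertices of the same height are adjacent. -/
def IsBalanced {V : Type*} (G : SimpleGraph V) : Prop :=
  ∀ u v : V, G.Adj u v → heightV G u ≠ heightV G v

/-- Minimal with respect to open neighborhoods. -/
def IsMinNbhd {V : Type*} (G : SimpleGraph V) (D : Set V) : Prop :=
  ∀ D' : Set V, D' ⊂ D → nbhd G D' ≠ nbhd G D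

theorem isMinTDS_of_private {V : Type*} {G : SimpleGraph V} {D : Set V}
    (hdom : ∀ u, ∃ a ∈ D, G.Adj a u)
    (hpriv : ∀ a ∈ D, ∃ u, G.Adj a u ∧ ∀ b ∈ D, G.Adj b u → b = a) : IsMinTDS G D := by
  refine ⟨Set.eq_univ_of_forall hdom, fun D' hD' hT => ?_⟩
  obtain ⟨a, haD, haD'⟩ := Set.exists_of_ssubset hD'
  obtain ⟨u, -, hu⟩ := hpriv a haD
  have hmem : u ∈ nbhd G D' := hT ▸ Set.mem_univ u
  obtain ⟨b, hb, hbu⟩ := hmem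
  exact haD' (hu b (hD'.subset hb) hbu ▸ hb)

/-- Targets that can be dominated from an allowed set can be dominated irredundantly from it. -/
theorem exists_irredundant_dominating {V : Type*} [Finite V] (G : SimpleGraph V)
    (targets allowed : Set V) (h : ∀ u ∈ targets, ∃ a ∈ allowed, G.Adj a u) :
    ∃ M ⊆ allowed, (∀ u ∈ targets, ∃ a ∈ M, G.Adj a u) ∧
      ∀ a ∈ M, ∃ u ∈ targets, G.Adj a u ∧ ∀ b ∈ M, G.Adj b u → b = a := by
  obtain ⟨M, -, hM⟩ := (Set.toFinite
    {M : Set V | M ⊆ allowed ∧ ∀ u ∈ targets, ∃ a ∈ M, G.Adj a u}).exists_le_minimal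
      ⟨subset_rfl, h⟩
  refine ⟨M, hM.prop.1, hM.prop.2, fun a ha => ?_⟩
  by_contra! hcon
  have hle := hM.le_of_le (y := M \ {a}) ⟨Set.sdiff_subset.trans hM.prop.1, fun u hu => by
    obtain ⟨b, hb, hbu⟩ := hM.prop.2 u hu
    by_cases hba : b = a
    · subst hba
      obtain ⟨c, hc, hcu, hcb⟩ := hcon u hu hbu
      exact ⟨c, ⟨hc, hcb⟩, hcu⟩
    · exact ⟨b, ⟨hb, hba⟩, hbu⟩⟩ Set.sdiff_subset
  exact (hle ha).2 rfl

section HeightV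

variable {V : Type*} {G : SimpleGraph V}

theorem heightV_le {u l : V} (hl : IsLeaf G l) : heightV G u ≤ G.dist u l :=
  Nat.sInf_le ⟨l, hl, rfl⟩

theorem exists_leaf_dist_eq_heightV (hex : ∃ l, IsLeaf G l) (u : V) :
    ∃ l, IsLeaf G l ∧ G.dist u l = heightV G u :=
  Nat.sInf_mem (s := {d | ∃ l, IsLeaf G l ∧ G.dist u l = d})
    (let ⟨l, hl⟩ := hex; ⟨_, l, hl, rfl⟩)

theorem heightV_eq_zero_iff (hG : G.Connected) (hex : ∃ l, IsLeaf G l) {u : V} :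
    heightV G u = 0 ↔ IsLeaf G u := by
  refine ⟨fun h => ?_, fun h => ?_⟩
  · obtain ⟨l, hl, hd⟩ := exists_leaf_dist_eq_heightV hex u
    rw [h, hG.dist_eq_zero_iff] at hd
    exact hd ▸ hl
  · simpa using heightV_le (u := u) h

theorem heightV_le_add_one_of_adj (hG : G.Connected) (hex : ∃ l, IsLeaf G l) {u w : V}
    (h : G.Adj u w) : heightV G u ≤ heightV G w + 1 := by
  obtain ⟨l, hl, hd⟩ := exists_leaf_dist_eq_heightV hex w
  have h1 := heightV_le (u := u) hl
  have h2 := hG.dist_triangle (u := u) (v := w) (w := l)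
  rw [SimpleGraph.dist_eq_one_iff_adj.mpr h] at h2
  omega

theorem exists_adj_dist_eq_add_one (hG : G.Connected) {u l : V} (h : u ≠ l) :
    ∃ b, G.Adj u b ∧ G.dist u l = G.dist b l + 1 := by
  obtain ⟨p, hp⟩ := hG.exists_walk_length_eq_dist u l
  cases p with
  | nil => exact absurd rfl h
  | cons hb q =>
    refine ⟨_, hb, ?_⟩
    have h1 := SimpleGraph.dist_le q
    have h2 := hG.dist_triangle (u := u) (v := _) (w := l) |>.trans_eq
      (congrArg (· + _) (SimpleGraph.dist_eq_one_iff_adj.mpr hb))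
    rw [SimpleGraph.Walk.length_cons] at hp
    omega

theorem exists_adj_heightV_eq_add_one (hG : G.Connected) (hex : ∃ l, IsLeaf G l) {u : V}
    (h : heightV G u ≠ 0) : ∃ b, G.Adj u b ∧ heightV G u = heightV G b + 1 := by
  obtain ⟨l, hl, hd⟩ := exists_leaf_dist_eq_heightV hex u
  have hul : u ≠ l := by
    rintro rfl
    exact h ((heightV_eq_zero_iff hG hex).mpr hl)
  obtain ⟨b, hb, hbd⟩ := exists_adj_dist_eq_add_one hG hul
  have h1 := heightV_le (u := b) hl
  have h2 := heightV_le_add_one_of_adj hG hex hb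
  exact ⟨b, hb, by omega⟩

end HeightV

/-- In a tree, a vertex has at most one neighbor closer to a given root. -/
theorem eq_of_adj_of_dist_eq_add_one {V : Type*} {G : SimpleGraph V} (hG : G.IsTree) {r u a b : V}
    (ha : G.Adj u a) (hb : G.Adj u b) (hda : G.dist r u = G.dist r a + 1)
    (hdb : G.dist r u = G.dist r b + 1) : a = b := by
  obtain ⟨p, -, hp⟩ := hG.connected.exists_path_of_dist r a
  obtain ⟨q, -, hq⟩ := hG.connected.exists_path_of_dist r b
  have hp' : (p.concat ha.symm).IsPath := SimpleGraph.Walk.isPath_of_length_eq_dist _ (by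
    rw [SimpleGraph.Walk.length_concat]; omega)
  have hq' : (q.concat hb.symm).IsPath := SimpleGraph.Walk.isPath_of_length_eq_dist _ (by
    rw [SimpleGraph.Walk.length_concat]; omega)
  have := (hG.existsUnique_path r u).unique hp' hq'
  obtain ⟨hab, -⟩ := SimpleGraph.Walk.concat_inj this
  exact hab

/-- The combinatorial core: `h` plays the role of the height and `d` that of the depth with
respect to a root which is a leaf. -/
theorem not_wtd_of_rooted_heights {V : Type*} [Finite V] (G : SimpleGraph V) (h d : V → ℕ)
    (hadj : ∀ a b, G.Adj a b → h a = h b + 1 ∨ h b = h a + 1)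
    (dadj : ∀ a b, G.Adj a b → d a = d b + 1 ∨ d b = d a + 1)
    (duniq : ∀ u a b, G.Adj u a → G.Adj u b → d u = d a + 1 → d u = d b + 1 → a = b)
    (down : ∀ u, h u ≠ 0 → ∃ b, G.Adj u b ∧ h u = h b + 1)
    (leaf : ∀ u a b, h u = 0 → G.Adj u a → G.Adj u b → a = b)
    (nonleaf : ∀ u, h u ≠ 0 → ∃ a b, G.Adj u a ∧ G.Adj u b ∧ a ≠ b)
    (nbr : ∀ u, ∃ b, G.Adj u b)
    (up : ∀ u, h u ≠ 0 → ∃ b, G.Adj u b ∧ d u = d b + 1)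
    (four : ∃ u, h u = 4) : ¬ WTD G := by
  have child : ∀ u, h u ≠ 0 → ∃ c, G.Adj u c ∧ d c = d u + 1 := by
    intro u hu
    obtain ⟨a, b, ha, hb, hab⟩ := nonleaf u hu
    rcases dadj _ _ ha with h1 | h1
    · rcases dadj _ _ hb with h2 | h2
      · exact absurd (duniq u a b ha hb h1 h2) hab
      · exact ⟨b, hb, h2⟩
    · exact ⟨a, ha, h1⟩
  -- a chosen child of every vertex of odd height, a leaf where possible
  have hk : ∀ u, ∃ c, h u % 2 = 1 → G.Adj u c ∧ d c = d u + 1 ∧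
      ((∃ x, G.Adj u x ∧ d u = d x + 1 ∧ h x = 2) → h u = 1 → h c = 0) := by
    intro u
    by_cases h1 : h u = 1 ∧ ∃ x, G.Adj u x ∧ d u = d x + 1 ∧ h x = 2
    · obtain ⟨h1, x, hx, hdx, hhx⟩ := h1
      obtain ⟨c, hc, hch⟩ := down u (by omega)
      refine ⟨c, fun _ => ⟨hc, ?_, fun _ _ => by omega⟩⟩
      rcases dadj _ _ hc with h2 | h2
      · have := duniq u c x hc hx h2 hdx
        subst this
        omega
      · exact h2
    · by_cases h0 : h u = 0
      · exact ⟨u, fun _ => by omega⟩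
      · obtain ⟨c, hc, hdc⟩ := child u h0
        exact ⟨c, fun _ => ⟨hc, hdc, fun hx h1' => absurd ⟨h1', hx⟩ h1⟩⟩
  choose k hk using hk
  -- a chosen child of height one below every vertex of height two whose parent is higher
  have he : ∀ t, ∃ y, h t = 2 → (∃ z, G.Adj t z ∧ d t = d z + 1 ∧ h z = 3) →
      G.Adj t y ∧ d y = d t + 1 ∧ h y = 1 := by
    intro t
    by_cases ht : h t = 2
    · obtain ⟨y, hy, hhy⟩ := down t (by omega)
      refine ⟨y, fun _ ⟨z, hz, hdz, hhz⟩ => ⟨hy, ?_, by omega⟩⟩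
      rcases dadj _ _ hy with h2 | h2
      · have := duniq t y z hy hz h2 hdz
        subst this
        omega
      · exact h2
    · exact ⟨t, fun h => absurd h ht⟩
  choose e he using he
  obtain ⟨v, ⟨hv2, hv4⟩, hvmax⟩ := (Set.toFinite {u | h u % 2 = 0 ∧ 4 ≤ h u}).exists_maximalFor d _
    (let ⟨u, hu⟩ := four; ⟨u, by simp [hu]⟩)
  have hdeep : ∀ u, d v < d u → h u % 2 = 0 → h u < 4 := by
    intro u hu hpar
    by_contra hlt
    have := hvmax ⟨hpar, by omega⟩ hu.le
    omega
  obtain ⟨p, hvp, hdp⟩ := up v (by omega)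
  have hhp := hadj _ _ hvp
  obtain ⟨s, hps, hds⟩ := up p (by omega)
  have hhs := hadj _ _ hps
  obtain ⟨q, hsq, hdq⟩ := up s (by omega)
  have hhq := hadj _ _ hsq
  obtain ⟨w₀, hw₀, hdw₀⟩ := child v (by omega)
  set W : Set V := {w | G.Adj v w ∧ d w = d v + 1}
  set X : Set V := k '' W
  set Y : Set V := {y | ∃ x ∈ X, G.Adj x y ∧ d y = d x + 1 ∧ h y = 1}
  set Z : Set V := {z | ∃ x ∈ X, G.Adj x z ∧ d z = d x + 1 ∧ h z = 3}
  have W_spec : ∀ w ∈ W, G.Adj v w ∧ d w = d v + 1 ∧ h w = 3 ∧ G.Adj w (k w) ∧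
      d (k w) = d v + 2 ∧ h (k w) = 2 := by
    rintro w ⟨hw, hdw⟩
    have h1 := hadj _ _ hw
    obtain ⟨hc, hdc, -⟩ := hk w (by omega)
    have h2 := hadj _ _ hc
    have h3 := hdeep (k w) (by omega) (by omega)
    exact ⟨hw, hdw, by omega, hc, by omega, by omega⟩
  have X_spec : ∀ x ∈ X, ∃ w ∈ W, x = k w ∧ G.Adj w x ∧ d x = d v + 2 ∧ h x = 2 := by
    rintro _ ⟨w, hw, rfl⟩
    have := W_spec w hw
    exact ⟨w, hw, rfl, this.2.2.2⟩
  have Y_spec : ∀ y ∈ Y, ∃ x ∈ X, G.Adj x y ∧ d x = d v + 2 ∧ d y = d v + 3 ∧ h y = 1 ∧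
      G.Adj y (k y) ∧ d (k y) = d v + 4 ∧ h (k y) = 0 := by
    rintro y ⟨x, hx, hxy, hdy, hhy⟩
    obtain ⟨w, -, -, -, hdx, hhx⟩ := X_spec x hx
    obtain ⟨h1, h2, h3⟩ := hk y (by omega)
    exact ⟨x, hx, hxy, hdx, by omega, hhy, h1, by omega, h3 ⟨x, hxy.symm, hdy, hhx⟩ hhy⟩
  have Z_spec : ∀ z ∈ Z, ∃ x ∈ X, G.Adj x z ∧ d z = d v + 3 ∧ h z = 3 ∧
      G.Adj z (k z) ∧ d (k z) = d v + 4 ∧ h (k z) = 2 ∧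
      G.Adj (k z) (e (k z)) ∧ d (e (k z)) = d v + 5 ∧ h (e (k z)) = 1 := by
    rintro z ⟨x, hx, hxz, hdz, hhz⟩
    obtain ⟨w, -, -, -, hdx, hhx⟩ := X_spec x hx
    obtain ⟨h1, h2, -⟩ := hk z (by omega)
    have h3 := hadj _ _ h1
    have h4 := hdeep (k z) (by omega) (by omega)
    have h5 : h (k z) = 2 := by omega
    obtain ⟨h6, h7, h8⟩ := he (k z) h5 ⟨z, h1.symm, h2, hhz⟩
    exact ⟨x, hx, hxz, by omega, hhz, h1, by omega, h5, h6, by omega, h8⟩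
  have par_unique : ∀ u a b, G.Adj a u → G.Adj b u → d u = d a + 1 → d u = d b + 1 → a = b :=
    fun u a b ha hb => duniq u a b ha.symm hb.symm
  set F : Set V := insert s (k '' Z) with hF
  set P : Set V := {u | u ∈ W ∨ u ∈ Y ∨ u = q ∨ ∃ z ∈ Z, u = e (k z)}
  have P_odd : ∀ m ∈ P, h m % 2 = 1 ∧ d q ≤ d m := by
    rintro m (hm | hm | rfl | ⟨z, hz, rfl⟩)
    · have := W_spec m hm; omega
    · obtain ⟨x, hx, hy⟩ := Y_spec m hm; omega
    · omega
    · obtain ⟨x, hx, hy⟩ := Z_spec z hz; omega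
  set targets : Set V := {u | ∀ a, a ∈ F ∨ a ∈ X ∨ a = v → ¬ G.Adj a u} with htargets
  set allowed : Set V := {a | ∀ m ∈ P, ¬ G.Adj a m}
  have feasible : ∀ u ∈ targets, ∃ a ∈ allowed, G.Adj a u := by
    intro u hu
    by_cases hpar : h u % 2 = 0
    · obtain ⟨b, hb⟩ := nbr u
      refine ⟨b, fun m hm hbm => ?_, hb.symm⟩
      have h1 := hadj _ _ hb
      have h2 := hadj _ _ hbm
      have h3 := P_odd m hm
      omega
    · obtain ⟨hc, hdc, -⟩ := hk u (by omega)
      by_cases hqc : G.Adj (k u) q ∧ d q = d (k u) + 1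
      · obtain ⟨b, hb, hdb⟩ := up u (by omega)
        refine ⟨b, fun m hm hbm => ?_, hb.symm⟩
        have h1 := dadj _ _ hbm
        have h3 := P_odd m hm
        omega
      · refine ⟨k u, fun m hm hcm => ?_, hc.symm⟩
        rcases dadj _ _ hcm with hd' | hd'
        · have := par_unique (k u) m u hcm.symm hc hd' hdc
          subst this
          rcases hm with hm | hm | rfl | ⟨z, hz, rfl⟩
          · exact hu v (by simp) hm.1
          · obtain ⟨x, hx, hxy, -⟩ := hm
            exact hu x (by simp [hx]) hxy
          · exact hu s (by simp [hF]) hsq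
          · obtain ⟨x, hx, hxz, -, -, -, -, -, h6, -⟩ := Z_spec z hz
            exact hu (k z) (by left; right; exact ⟨z, hz, rfl⟩) h6
        · rcases hm with hm | hm | rfl | ⟨z, hz, rfl⟩
          · have := par_unique m (k u) v hcm hm.1 hd' hm.2
            exact hu v (by simp) (this ▸ hc.symm)
          · obtain ⟨x, hx, hxy, hdy, -⟩ := hm
            have := par_unique m (k u) x hcm hxy hd' hdy
            exact hu x (by simp [hx]) (this ▸ hc.symm)
          · exact hqc ⟨hcm, hd'⟩
          · obtain ⟨x, hx, hxz, -, -, -, h4, -, h6, h7, -⟩ := Z_spec z hz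
            have := par_unique _ (k u) (k z) hcm h6 hd' (by omega)
            exact hu (k z) (by left; right; exact ⟨z, hz, rfl⟩) (this ▸ hc.symm)
  obtain ⟨M, hMa, hMdom, hMpriv⟩ := exists_irredundant_dominating G targets allowed feasible
  have hw₀W : w₀ ∈ W := ⟨hw₀, hdw₀⟩
  have min₁ : IsMinTDS G ((M ∪ F) ∪ X) := by
    apply isMinTDS_of_private
    · intro u
      by_cases hu : u ∈ targets
      · obtain ⟨a, ha, hau⟩ := hMdom u hu
        exact ⟨a, .inl (.inl ha), hau⟩
      · simp only [htargets, Set.mem_ofPred_eq, not_forall, not_not] at hu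
        obtain ⟨a, ha | ha | rfl, hau⟩ := hu
        · exact ⟨a, .inl (.inr ha), hau⟩
        · exact ⟨a, .inr ha, hau⟩
        · rcases dadj _ _ hau with h1 | h1
          · have := duniq _ u p hau hvp h1 hdp
            exact ⟨s, .inl (.inr (.inl rfl)), this ▸ hps.symm⟩
          · exact ⟨k u, .inr ⟨u, ⟨hau, h1⟩, rfl⟩, (W_spec u ⟨hau, h1⟩).2.2.2.1.symm⟩
    · rintro a ((ha | (rfl | ⟨z, hz, rfl⟩)) | ha)
      · obtain ⟨u, hu, hau, hun⟩ := hMpriv a ha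
        refine ⟨u, hau, ?_⟩
        rintro b ((hb | hb) | hb) hbu
        · exact hun b hb hbu
        · exact absurd hbu (hu b (.inl hb))
        · exact absurd hbu (hu b (.inr (.inl hb)))
      · refine ⟨q, hsq, ?_⟩
        rintro b ((hb | (rfl | ⟨z, hz, rfl⟩)) | hb) hbu
        · exact absurd hbu (hMa hb q (.inr (.inr (.inl rfl))))
        · rfl
        · obtain ⟨x, hx, hz⟩ := Z_spec z hz
          have := dadj _ _ hbu
          omega
        · obtain ⟨w, hx, hz⟩ := X_spec b hb
          have := dadj _ _ hbu
          omega
      · obtain ⟨-, -, -, -, -, -, h4, -, h6, h7, -⟩ := Z_spec z hz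
        refine ⟨e (k z), h6, ?_⟩
        rintro b ((hb | (rfl | ⟨z', hz', rfl⟩)) | hb) hbu
        · exact absurd hbu (hMa hb _ (.inr (.inr (.inr ⟨z, hz, rfl⟩))))
        · have := dadj _ _ hbu
          omega
        · obtain ⟨-, -, -, -, -, -, h4', -⟩ := Z_spec z' hz'
          exact par_unique _ _ _ hbu h6 (by omega) (by omega)
        · obtain ⟨w, hx, hz⟩ := X_spec b hb
          have := dadj _ _ hbu
          omega
      · obtain ⟨w, hw, rfl, hwx, hdx, -⟩ := X_spec a ha
        have hdw := hw.2
        refine ⟨w, hwx.symm, ?_⟩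
        rintro b ((hb | (rfl | ⟨z', hz', rfl⟩)) | hb) hbu
        · exact absurd hbu (hMa hb _ (.inl hw))
        · have := dadj _ _ hbu
          omega
        · obtain ⟨-, -, -, -, -, -, h4', -⟩ := Z_spec z' hz'
          have := dadj _ _ hbu
          omega
        · obtain ⟨w', hw', rfl, hwx', hdx', -⟩ := X_spec b hb
          have := par_unique _ w' w hwx' hbu.symm (by have := hw'.2; omega) (by omega)
          rw [this]
  have min₂ : IsMinTDS G ((M ∪ F) ∪ insert v (k '' Y)) := by
    apply isMinTDS_of_private
    · intro u
      by_cases hu : u ∈ targets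
      · obtain ⟨a, ha, hau⟩ := hMdom u hu
        exact ⟨a, .inl (.inl ha), hau⟩
      · simp only [htargets, Set.mem_ofPred_eq, not_forall, not_not] at hu
        obtain ⟨a, ha | ha | rfl, hau⟩ := hu
        · exact ⟨a, .inl (.inr ha), hau⟩
        · obtain ⟨w, hw, -, hwa, hda, hha⟩ := X_spec a ha
          rcases dadj _ _ hau with h1 | h1
          · have := duniq a u w hau hwa.symm h1 (by have := hw.2; omega)
            exact ⟨v, .inr (.inl rfl), this ▸ hw.1⟩
          · rcases hadj _ _ hau with h2 | h2
            · have huY : u ∈ Y := ⟨a, ha, hau, h1, by omega⟩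
              obtain ⟨-, -, -, -, -, -, h3, -⟩ := Y_spec u huY
              exact ⟨k u, .inr (.inr ⟨u, huY, rfl⟩), h3.symm⟩
            · have huZ : u ∈ Z := ⟨a, ha, hau, h1, by omega⟩
              obtain ⟨-, -, -, -, -, h3, -⟩ := Z_spec u huZ
              exact ⟨k u, .inl (.inr (.inr ⟨u, huZ, rfl⟩)), h3.symm⟩
        · exact ⟨a, .inr (.inl rfl), hau⟩
    · rintro a ((ha | (rfl | ⟨z, hz, rfl⟩)) | (rfl | ⟨y, hy, rfl⟩))
      · obtain ⟨u, hu, hau, hun⟩ := hMpriv a ha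
        refine ⟨u, hau, ?_⟩
        rintro b ((hb | hb) | (rfl | ⟨y, hy, rfl⟩)) hbu
        · exact hun b hb hbu
        · exact absurd hbu (hu b (.inl hb))
        · exact absurd hbu (hu b (.inr (.inr rfl)))
        · obtain ⟨x, hx, hxy, -, -, -, h3, -, h5⟩ := Y_spec y hy
          have := leaf _ u y h5 hbu h3.symm
          exact absurd (this ▸ hxy) (hu x (.inr (.inl hx)))
      · refine ⟨q, hsq, ?_⟩
        rintro b ((hb | (rfl | ⟨z, hz, rfl⟩)) | (rfl | ⟨y, hy, rfl⟩)) hbu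
        · exact absurd hbu (hMa hb q (.inr (.inr (.inl rfl))))
        · rfl
        · obtain ⟨x, hx, hz⟩ := Z_spec z hz
          have := dadj _ _ hbu
          omega
        · have := dadj _ _ hbu
          omega
        · obtain ⟨x, hx, hz⟩ := Y_spec y hy
          have := dadj _ _ hbu
          omega
      · obtain ⟨-, -, -, -, -, -, h4, -, h6, h7, -⟩ := Z_spec z hz
        refine ⟨e (k z), h6, ?_⟩
        rintro b ((hb | (rfl | ⟨z', hz', rfl⟩)) | (rfl | ⟨y, hy, rfl⟩)) hbu
        · exact absurd hbu (hMa hb _ (.inr (.inr (.inr ⟨z, hz, rfl⟩))))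
        · have := dadj _ _ hbu
          omega
        · obtain ⟨-, -, -, -, -, -, h4', -⟩ := Z_spec z' hz'
          exact par_unique _ _ _ hbu h6 (by omega) (by omega)
        · have := dadj _ _ hbu
          omega
        · obtain ⟨x, hx, hxy, -, -, -, h3, h4', h5⟩ := Y_spec y hy
          exact par_unique _ _ _ hbu h6 (by omega) (by omega)
      · refine ⟨w₀, hw₀, ?_⟩
        rintro b ((hb | (rfl | ⟨z', hz', rfl⟩)) | (rfl | ⟨y, hy, rfl⟩)) hbu
        · exact absurd hbu (hMa hb _ (.inl hw₀W))
        · have := dadj _ _ hbu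
          omega
        · obtain ⟨-, -, -, -, -, -, h4', -⟩ := Z_spec z' hz'
          have := dadj _ _ hbu
          omega
        · rfl
        · obtain ⟨x, hx, hz⟩ := Y_spec y hy
          have := dadj _ _ hbu
          omega
      · obtain ⟨x, hx, hxy, -, hdy, hhy, h3, -, h5⟩ := Y_spec y hy
        refine ⟨y, h3.symm, ?_⟩
        rintro b ((hb | (rfl | ⟨z', hz', rfl⟩)) | (rfl | ⟨y', hy', rfl⟩)) hbu
        · exact absurd hbu (hMa hb _ (.inr (.inl hy)))
        · have := dadj _ _ hbu
          omega
        · obtain ⟨-, -, -, hdz, hhz, h1, h4', -⟩ := Z_spec z' hz'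
          have := par_unique _ _ _ hbu.symm h1 (by omega) (by omega)
          subst this
          omega
        · have := dadj _ _ hbu
          omega
        · obtain ⟨-, -, -, -, -, -, h3', -, h5'⟩ := Y_spec y' hy'
          rw [leaf _ y y' h5' hbu h3'.symm]
  have hdisj : Disjoint (M ∪ F) (insert v (k '' Y)) := by
    rw [Set.disjoint_left]
    rintro a (ha | (rfl | ⟨z, hz, rfl⟩)) (hb | ⟨y, hy, hb⟩)
    · subst hb
      exact hMa ha w₀ (.inl hw₀W) hw₀
    · subst hb
      obtain ⟨-, -, -, -, -, -, h3, -⟩ := Y_spec y hy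
      exact hMa ha y (.inr (.inl hy)) h3.symm
    · have := congrArg d hb
      omega
    · have := congrArg d hb
      have := Y_spec y hy
      grind
    · have := congrArg d hb
      have := Z_spec z hz
      grind
    · have := congrArg h hb
      have := Y_spec y hy
      have := Z_spec z hz
      grind
  have hv_notin : v ∉ k '' Y := by
    rintro ⟨y, hy, hyv⟩
    have := congrArg h hyv
    have := Y_spec y hy
    grind
  have X_le : X.ncard ≤ (k '' Y).ncard := by
    have hex : ∀ x, ∃ y, x ∈ X → y ∈ Y ∧ G.Adj x y := by
      intro x
      by_cases hx : x ∈ X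
      · obtain ⟨w, hw, -, hwx, hdx, hhx⟩ := X_spec x hx
        obtain ⟨h1, h2, h3⟩ := he x hhx ⟨w, hwx.symm, by have := hw.2; omega, (W_spec w hw).2.2.1⟩
        exact ⟨e x, fun _ => ⟨⟨x, hx, h1, h2, h3⟩, h1⟩⟩
      · exact ⟨x, fun h => absurd h hx⟩
    choose f hf using hex
    refine Set.ncard_le_ncard_of_injOn (fun x => k (f x)) (fun x hx => ⟨f x, (hf x hx).1, rfl⟩) ?_
    intro x hx x' hx' hxx
    obtain ⟨hy, hxy⟩ := hf x hx
    obtain ⟨hy', hxy'⟩ := hf x' hx'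
    obtain ⟨-, -, -, -, hdy, -, h3, h4, -⟩ := Y_spec _ hy
    obtain ⟨-, -, -, -, hdy', -, h3', h4', -⟩ := Y_spec _ hy'
    change k (f x) = k (f x') at hxx
    have hff := par_unique _ _ _ h3 (hxx ▸ h3') (by omega) (by omega)
    obtain ⟨-, -, -, -, hdx, -⟩ := X_spec x hx
    obtain ⟨-, -, -, -, hdx', -⟩ := X_spec x' hx'
    exact par_unique _ _ _ hxy (hff ▸ hxy') (by omega) (by omega)
  intro hwtd
  have heq := hwtd _ _ min₁ min₂
  have h1 := Set.ncard_union_le (M ∪ F) X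
  rw [Set.ncard_union_eq hdisj, Set.ncard_insert_of_notMem hv_notin] at heq
  omega

theorem stmt12 {V : Type*} [Fintype V] (T : SimpleGraph V) (htree : T.IsTree)
    (hbal : IsBalanced T) (hh : 4 ≤ heightG T) :
    ¬ WTD T := by
  have hG := htree.connected
  have hne : {d | ∃ v, heightV T v = d}.Nonempty := ⟨_, hG.nonempty.some, rfl⟩
  obtain ⟨v₀, hv₀⟩ := Nat.sSup_mem hne (Set.finite_range (heightV T)).bddAbove
  change heightV T v₀ = heightG T at hv₀
  have hex : ∃ l, IsLeaf T l := by
    by_contra hno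
    have : heightV T v₀ = 0 := by
      unfold heightV
      rw [Nat.sInf_eq_zero]
      right
      ext d
      simp only [Set.mem_ofPred_eq, Set.mem_empty_iff_false, iff_false]
      rintro ⟨l, hl, -⟩
      exact hno ⟨l, hl⟩
    omega
  obtain ⟨r, hr⟩ := hex
  have hr0 := (heightV_eq_zero_iff hG ⟨r, hr⟩).mpr hr
  refine not_wtd_of_rooted_heights T (heightV T) (T.dist r) ?_ ?_ ?_ ?_ ?_ ?_ ?_ ?_ ?_
  · intro a b hab
    have h1 := heightV_le_add_one_of_adj hG ⟨r, hr⟩ hab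
    have h2 := heightV_le_add_one_of_adj hG ⟨r, hr⟩ hab.symm
    have h3 := hbal a b hab
    omega
  · exact fun a b hab => htree.dist_eq_dist_add_one_of_adj r hab
  · exact fun u a b ha hb hda hdb => eq_of_adj_of_dist_eq_add_one htree ha hb hda hdb
  · exact fun u hu => exists_adj_heightV_eq_add_one hG ⟨r, hr⟩ hu
  · intro u a b hu ha hb
    obtain ⟨c, hc⟩ := Set.ncard_eq_one.mp ((heightV_eq_zero_iff hG ⟨r, hr⟩).mp hu)
    have ha' : a ∈ T.neighborSet u := ha
    have hb' : b ∈ T.neighborSet u := hb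
    rw [hc] at ha' hb'
    exact ha'.trans hb'.symm
  · intro u hu
    obtain ⟨a, ha, -⟩ := exists_adj_heightV_eq_add_one hG ⟨r, hr⟩ hu
    by_contra! hcon
    refine hu ((heightV_eq_zero_iff hG ⟨r, hr⟩).mpr (Set.ncard_eq_one.mpr ⟨a, ?_⟩))
    ext b
    exact ⟨fun hb => (hcon a b ha hb).symm, fun hb => hb ▸ ha⟩
  · intro u
    by_cases hu : heightV T u = 0
    · obtain ⟨c, hc⟩ := Set.ncard_eq_one.mp ((heightV_eq_zero_iff hG ⟨r, hr⟩).mp hu)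
      exact ⟨c, show c ∈ T.neighborSet u from hc ▸ rfl⟩
    · obtain ⟨a, ha, -⟩ := exists_adj_heightV_eq_add_one hG ⟨r, hr⟩ hu
      exact ⟨a, ha⟩
  · intro u hu
    obtain ⟨b, hb, hd⟩ := exists_adj_dist_eq_add_one hG (u := u) (l := r)
      (by rintro rfl; exact hu hr0)
    exact ⟨b, hb, by rw [T.dist_comm, hd, T.dist_comm]⟩
  · have key : ∀ n, ∀ u, heightV T u = n → 4 ≤ n → ∃ w, heightV T w = 4 := by
      intro n
      induction n with
      | zero => intro u _ h; omega
      | succ n ih =>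
        intro u hu hn
        by_cases h4 : n = 3
        · exact ⟨u, by omega⟩
        · obtain ⟨b, -, hb⟩ := exists_adj_heightV_eq_add_one hG ⟨r, hr⟩ (u := u) (by omega)
          exact ih b (by omega) (by omega)
    exact key _ v₀ rfl (by omega)
end

section
/- A balanced tree T is well-totally dominated if and only if (1) height(T) ≤ 3, (2) every vertex of height 2 has exactly one neighbor of height 1, and (3) every vertex of height 1 has at most one neighbor of height 2. -/
open SimpleGraph Set

section Acyclic

variable {V : Type*} {G : SimpleGraph V}

/-- A nonbacktracking closed walk does not exist in an acyclic graph. -/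
lemma SimpleGraph.IsAcyclic.not_isChain_edges (hG : G.IsAcyclic) {v w : V} (hvw : G.Adj v w)
    (p : G.Walk w v) : ¬ List.IsChain (· ≠ ·) (Walk.cons hvw p).edges := by
  intro h
  have := (hG.isPath_iff_isChain _).2 h
  rw [Walk.cons_isPath_iff] at this
  exact this.2 p.end_mem_support

lemma SimpleGraph.IsAcyclic.eq_of_adj_four (hG : G.IsAcyclic) {a b c d : V} (hab : G.Adj a b)
    (hbc : G.Adj b c) (hcd : G.Adj c d) (hda : G.Adj d a) (hac : a ≠ c) : b = d := by
  by_contra hbd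
  refine hG.not_isChain_edges hab (.cons hbc (.cons hcd (.cons hda .nil))) ?_
  have := hab.ne; have := hbc.ne; have := hcd.ne; have := hda.ne
  simp only [Walk.edges_cons, Walk.edges_nil, List.isChain_cons_cons, List.isChain_singleton, ne_eq,
    Sym2.eq_iff]
  grind

lemma SimpleGraph.IsAcyclic.false_of_adj_six (hG : G.IsAcyclic) {a b c d e f : V}
    (hab : G.Adj a b) (hbc : G.Adj b c) (hcd : G.Adj c d) (hde : G.Adj d e) (hef : G.Adj e f)
    (hfa : G.Adj f a) (hac : a ≠ c) (hbd : b ≠ d) (hce : c ≠ e) (hdf : d ≠ f) : False := by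
  refine hG.not_isChain_edges hab (.cons hbc (.cons hcd (.cons hde (.cons hef (.cons hfa .nil))))) ?_
  have : e ≠ a := by
    rintro rfl
    exact hbd (hG.eq_of_adj_four hab hbc hcd hde hac)
  have := hab.ne; have := hbc.ne; have := hcd.ne; have := hde.ne; have := hef.ne; have := hfa.ne
  simp only [Walk.edges_cons, Walk.edges_nil, List.isChain_cons_cons, List.isChain_singleton, ne_eq,
    Sym2.eq_iff]
  grind

lemma SimpleGraph.IsAcyclic.false_of_adj_eight (hG : G.IsAcyclic) {a b c d e f g i : V}
    (hab : G.Adj a b) (hbc : G.Adj b c) (hcd : G.Adj c d) (hde : G.Adj d e) (hef : G.Adj e f)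
    (hfg : G.Adj f g) (hgi : G.Adj g i) (hia : G.Adj i a) (hac : a ≠ c) (hbd : b ≠ d)
    (hce : c ≠ e) (hdf : d ≠ f) (heg : e ≠ g) (hfi : f ≠ i) (hga : g ≠ a) : False := by
  refine hG.not_isChain_edges hab
    (.cons hbc (.cons hcd (.cons hde (.cons hef (.cons hfg (.cons hgi (.cons hia .nil))))))) ?_
  have := hab.ne; have := hbc.ne; have := hcd.ne; have := hde.ne; have := hef.ne
  have := hfg.ne; have := hgi.ne; have := hia.ne
  simp only [Walk.edges_cons, Walk.edges_nil, List.isChain_cons_cons, List.isChain_singleton, ne_eq,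
    Sym2.eq_iff]
  grind

end Acyclic

section TotalDomination

variable {V : Type*} {G : SimpleGraph V}

lemma isTDS_iff {D : Set V} : IsTDS G D ↔ ∀ v, ∃ u ∈ D, G.Adj u v := by
  simp [IsTDS, nbhd, Set.eq_univ_iff_forall]

lemma IsTDS.exists_isMinTDS [Finite V] {D : Set V} (hD : IsTDS G D) :
    ∃ D' ⊆ D, IsMinTDS G D' := by
  obtain ⟨D', hle, hmin⟩ := exists_minimal_le_of_wellFoundedLT (IsTDS G) D hD
  exact ⟨D', hle, hmin.prop, fun E hE hE' => hE.2 (hmin.le_of_le hE' hE.1)⟩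

lemma WTD.ncard_le [Finite V] (hG : WTD G) {D E : Set V} (hD : IsMinTDS G D) (hE : IsTDS G E) :
    D.ncard ≤ E.ncard := by
  obtain ⟨E', hle, hE'⟩ := hE.exists_isMinTDS
  exact hG D E' hD hE' ▸ Set.ncard_le_ncard hle

lemma WTD.isMinTDS_of_ncard_le [Finite V] (hG : WTD G) {D E : Set V} (hD : IsMinTDS G D)
    (hE : IsTDS G E) (hle : E.ncard ≤ D.ncard) : IsMinTDS G E :=
  ⟨hE, fun _ hlt hF => (Set.ncard_lt_ncard hlt).not_ge (hle.trans (hG.ncard_le hD hF))⟩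

/-- Avoiding a set `X` that contains no whole open neighborhood, one still finds a minimal total
dominating set. -/
lemma exists_isMinTDS_disjoint [Finite V] (X : Set V) (hX : ∀ v, ∃ u, G.Adj v u ∧ u ∉ X) :
    ∃ D, IsMinTDS G D ∧ ∀ u ∈ D, u ∉ X := by
  have : IsTDS G Xᶜ := isTDS_iff.2 fun v => by
    obtain ⟨u, h, hu⟩ := hX v
    exact ⟨u, hu, h.symm⟩
  obtain ⟨D, hle, hD⟩ := this.exists_isMinTDS
  exact ⟨D, hD, fun u hu => hle hu⟩

/-- The properties of the height function of a balanced tree that are used below. -/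
structure IsBalancedHeight (G : SimpleGraph V) (h : V → ℕ) : Prop where
  step : ∀ {u v}, G.Adj u v → h u = h v + 1 ∨ h v = h u + 1
  exists_lower : ∀ {v}, h v ≠ 0 → ∃ u, G.Adj v u ∧ h v = h u + 1
  eq_zero_iff : ∀ {v}, h v = 0 ↔ IsLeaf G v

namespace IsBalancedHeight

variable {h : V → ℕ}

lemma exists_adj (hh : IsBalancedHeight G h) (v : V) : ∃ u, G.Adj v u := by
  by_cases hv : h v = 0
  · obtain ⟨u, hu⟩ := Set.ncard_eq_one.1 (hh.eq_zero_iff.1 hv)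
    exact ⟨u, by rw [← mem_neighborSet, hu]; rfl⟩
  · exact (hh.exists_lower hv).imp fun _ h => h.1

lemma exists_adj_ne (hh : IsBalancedHeight G h)
    {v a : V} (hv : h v ≠ 0) (ha : G.Adj v a) : ∃ b, G.Adj v b ∧ b ≠ a := by
  by_contra! hc
  refine hv (hh.eq_zero_iff.2 (Set.ncard_eq_one.2 ⟨a, ?_⟩))
  ext b
  exact ⟨hc b, fun hb => by rwa [Set.mem_singleton_iff.1 hb]⟩

lemma eq_of_leaf (hh : IsBalancedHeight G h)
    {l a b : V} (hl : h l = 0) (ha : G.Adj l a) (hb : G.Adj l b) : a = b := by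
  obtain ⟨u, hu⟩ := Set.ncard_eq_one.1 (hh.eq_zero_iff.1 hl)
  have ha' : a ∈ G.neighborSet l := ha
  have hb' : b ∈ G.neighborSet l := hb
  rw [hu] at ha' hb'
  exact ha'.trans hb'.symm

lemma odd_iff (hh : IsBalancedHeight G h)
    {u v : V} (huv : G.Adj u v) : Odd (h u) ↔ ¬ Odd (h v) := by
  have := hh.step huv
  grind

lemma support_mem (hh : IsBalancedHeight G h)
    {D : Set V} (hD : IsTDS G D) {s : V} (hs : h s = 1) : s ∈ D := by
  obtain ⟨l, hl, hl'⟩ := hh.exists_lower (by rw [hs]; exact one_ne_zero)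
  obtain ⟨t, ht, htl⟩ := isTDS_iff.1 hD l
  rwa [hh.eq_of_leaf (by omega) hl.symm htl.symm]

lemma exists_height_eq (hh : IsBalancedHeight G h)
    {v : V} {k : ℕ} (hk : k ≤ h v) : ∃ u, h u = k := by
  obtain ⟨n, hn⟩ := Nat.exists_eq_add_of_le hk
  induction n generalizing v with
  | zero => exact ⟨v, hn⟩
  | succ n ih =>
    obtain ⟨u, -, hu⟩ := hh.exists_lower (v := v) (by omega)
    exact ih (v := u) (by omega) (by omega)

/-- Two neighbors of a vertex `v` of odd height lie in a common minimal total dominating set,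
provided neither is a leaf. -/
lemma exists_isMinTDS_mem_mem [Finite V] (hh : IsBalancedHeight G h)
    (hG : G.IsAcyclic) {v u w : V} (hv : Odd (h v))
    (hvu : G.Adj v u) (hvw : G.Adj v w) (huw : u ≠ w) (hu : h u ≠ 0) (hw : h w ≠ 0) :
    ∃ A, IsMinTDS G A ∧ u ∈ A ∧ w ∈ A := by
  obtain ⟨x, hux, hxv⟩ := hh.exists_adj_ne hu hvu.symm
  obtain ⟨y, hwy, hyv⟩ := hh.exists_adj_ne hw hvw.symm
  have huy : ¬ G.Adj y u := fun hyu =>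
    huw (hG.eq_of_adj_four hvu hyu.symm hwy.symm hvw.symm hyv.symm)
  have hwx : ¬ G.Adj x w := fun hxw =>
    huw (hG.eq_of_adj_four hvu hux hxw hvw.symm hxv.symm)
  have hodd := @hh.odd_iff
  obtain ⟨A, hA, hAX⟩ := exists_isMinTDS_disjoint (G := G)
      {z | (G.Adj x z ∧ z ≠ u) ∨ (G.Adj y z ∧ z ≠ w)} fun z => by
    by_contra! hz
    simp only [Set.mem_ofPred_eq] at hz
    have hzx : z ≠ x := by rintro rfl; grind [G.adj_comm]
    have hzy : z ≠ y := by rintro rfl; grind [G.adj_comm]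
    have hzv : z ≠ v := by rintro rfl; grind [G.adj_comm]
    obtain ⟨a, hza⟩ := hh.exists_adj z
    have ha := hz a hza
    have hzodd : Odd (h z) := by grind [G.adj_comm]
    obtain ⟨b, hzb, hba⟩ := hh.exists_adj_ne (by rintro h0; simp [h0] at hzodd) hza
    have hb := hz b hzb
    have key : ∀ {a b}, G.Adj z a → G.Adj z b → b ≠ a → G.Adj x a → a ≠ u → G.Adj y b → b ≠ w →
        False := fun hza hzb hba hxa hau hyb hbw =>
      hG.false_of_adj_eight hza hxa.symm hux.symm hvu.symm hvw hwy hyb hzb.symm hzx hau hxv huw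
        hyv.symm hbw.symm hzy.symm
    rcases ha with ⟨ha, hau⟩ | ⟨ha, haw⟩ <;> rcases hb with ⟨hb, hbu⟩ | ⟨hb, hbw⟩
    · exact hzx (hG.eq_of_adj_four hza.symm hzb hb.symm ha hba.symm)
    · exact key hza hzb hba ha hau hb hbw
    · exact key hzb hza hba.symm hb hbu ha haw
    · exact hzy (hG.eq_of_adj_four hza.symm hzb hb.symm ha hba.symm)
  refine ⟨A, hA, ?_, ?_⟩
  · obtain ⟨u', hu', hadj⟩ := isTDS_iff.1 hA.1 x
    have := hAX u' hu'
    by_contra hne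
    exact this (Or.inl ⟨hadj.symm, by rintro rfl; exact hne hu'⟩)
  · obtain ⟨u', hu', hadj⟩ := isTDS_iff.1 hA.1 y
    have := hAX u' hu'
    by_contra hne
    exact this (Or.inr ⟨hadj.symm, by rintro rfl; exact hne hu'⟩)

/-- If a minimal total dominating set `A` contains two neighbors `u`, `w` of `v`, then its part `U`
in the branch at `u` can be transplanted into any minimal total dominating set at no cost. -/
lemma exists_exchange [Finite V] (hh : IsBalancedHeight G h)
    (hG : G.IsAcyclic) (hW : WTD G) {v u w : V} (hv : Odd (h v))
    (hvu : G.Adj v u) (hvw : G.Adj v w) (huw : u ≠ w) {A : Set V} (hA : IsMinTDS G A)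
    (huA : u ∈ A) (hwA : w ∈ A) :
    ∃ U : Set V, u ∈ U ∧ (∀ y, G.Adj v y → y ∈ U → y = u) ∧
      (∀ v' y, G.Adj w v' → v' ≠ v → G.Adj v' y → y ∉ U) ∧
      ∀ B, IsMinTDS G B → IsTDS G ((A ∩ U) ∪ (B \ U)) ∧
        ((A ∩ U) ∪ (B \ U)).ncard ≤ B.ncard := by
  set R : V → Prop := fun x => (G.deleteEdges {s(u, v)}).Reachable u x with hR
  have hRu : R u := Reachable.refl _
  have hRv : ¬ R v := isAcyclic_iff_forall_adj_isBridge.1 hG hvu.symm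
  have cross : ∀ {x y}, G.Adj x y → R x → ¬ (x = u ∧ y = v) → ¬ (x = v ∧ y = u) → R y := by
    intro x y hxy hx h1 h2
    refine hx.trans (Adj.reachable ?_)
    rw [deleteEdges_adj]
    refine ⟨hxy, ?_⟩
    rw [Set.mem_singleton_iff, Sym2.eq_iff]
    tauto
  have hodd := @hh.odd_iff
  have hu : ¬ Odd (h u) := (hodd hvu).1 hv
  set U : Set V := {x | ¬ Odd (h x) ∧ R x} with hU
  have memU : ∀ x, x ∈ U ↔ ¬ Odd (h x) ∧ R x := fun _ => Iff.rfl
  have only : ∀ y, G.Adj v y → y ∈ U → y = u := fun y hvy hy => by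
    by_contra hne
    exact hRv (cross hvy.symm hy.2 (fun h => hne h.1) fun h => hvy.ne h.1.symm)
  have mix : ∀ {A B : Set V}, IsTDS G A → IsTDS G B → (∃ t ∈ (A ∩ U) ∪ (B \ U), G.Adj t v) →
      IsTDS G ((A ∩ U) ∪ (B \ U)) := by
    intro A B hA hB hdom
    refine isTDS_iff.2 fun z => ?_
    by_cases hzv : z = v
    · exact hzv ▸ hdom
    by_cases hz : Odd (h z) ∧ R z
    · obtain ⟨t, ht, htz⟩ := isTDS_iff.1 hA z
      refine ⟨t, Or.inl ⟨ht, (hodd htz.symm).1 hz.1, cross htz.symm hz.2 ?_ ?_⟩, htz⟩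
      · rintro ⟨rfl, -⟩
        exact hu hz.1
      · exact fun h => hzv h.1
    · obtain ⟨t, ht, htz⟩ := isTDS_iff.1 hB z
      refine ⟨t, Or.inr ⟨ht, fun htU => hz ⟨?_, cross htz htU.2 (fun h => hzv h.2) ?_⟩⟩, htz⟩
      · exact (hodd htz.symm).2 htU.1
      · rintro ⟨rfl, -⟩
        exact hRv htU.2
  have card : ∀ A B : Set V, ((A ∩ U) ∪ (B \ U)).ncard = (A ∩ U).ncard + (B \ U).ncard :=
    fun A B => Set.ncard_union_eq (Set.disjoint_left.2 fun x hx hx' => hx'.2 hx.2)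
  have hwU : w ∉ U := fun hw => huw (only w hvw hw).symm
  refine ⟨U, ⟨hu, hRu⟩, only, fun v' y hwv' hv' hv'y hy => ?_, fun B hB => ⟨?_, ?_⟩⟩
  · have hv'odd : Odd (h v') := (hodd hv'y).2 hy.1
    have hRv' : R v' := cross hv'y.symm hy.2 (fun h => hv' h.2) fun h => hRv (h.1 ▸ hy.2)
    refine hwU ⟨(hodd hvw).1 hv, cross hwv'.symm hRv' (fun h => hu (h.1 ▸ hv'odd)) fun h => hv' h.1⟩
  · exact mix hA.1 hB.1 ⟨u, Or.inl ⟨huA, hu, hRu⟩, hvu.symm⟩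
  · have := hW.ncard_le hA (mix hB.1 hA.1 ⟨w, Or.inr ⟨hwA, hwU⟩, hvw.symm⟩)
    rw [card] at this ⊢
    have h1 := Set.ncard_inter_add_ncard_sdiff_eq_ncard A U
    have h2 := Set.ncard_inter_add_ncard_sdiff_eq_ncard B U
    omega

lemma height_ne_four [Finite V] (hh : IsBalancedHeight G h)
    (hG : G.IsAcyclic) (hW : WTD G) (w : V) : h w ≠ 4 := by
  intro hw
  have hnb : ∀ v, G.Adj w v → Odd (h v) ∧ 3 ≤ h v := fun v hwv => by
    have := hh.step hwv
    grind
  have hpair : ∀ v, G.Adj w v → ∃ u A, G.Adj v u ∧ u ≠ w ∧ IsMinTDS G A ∧ u ∈ A ∧ w ∈ A := by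
    intro v hwv
    obtain ⟨hodd, hv⟩ := hnb v hwv
    obtain ⟨u, hvu, huw⟩ := hh.exists_adj_ne (by omega) hwv.symm
    have := hh.step hvu
    obtain ⟨A, hA, huA, hwA⟩ :=
      hh.exists_isMinTDS_mem_mem hG hodd hvu hwv.symm huw (by omega) (by omega)
    exact ⟨u, A, hvu, huw, hA, huA, hwA⟩
  let bad : Set V → Set V := fun B => {v | G.Adj w v ∧ ∀ t ∈ B, G.Adj t v → t = w}
  have key : ∀ n, ∀ B, IsMinTDS G B → w ∈ B → (bad B).ncard = n → False := by
    intro n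
    induction n using Nat.strong_induction_on with
    | _ n ih =>
      intro B hB hwB hn
      rcases (bad B).eq_empty_or_nonempty with hbad | ⟨v, hwv, hv⟩
      · refine hB.2 (B \ {w}) (Set.sdiff_singleton_ssubset.2 hwB) (isTDS_iff.2 fun z => ?_)
        obtain ⟨t, ht, htz⟩ := isTDS_iff.1 hB.1 z
        by_cases htw : t = w
        · have hz : z ∉ bad B := by simp [hbad]
          have : ¬ ∀ t ∈ B, G.Adj t z → t = w := fun h => hz ⟨htw ▸ htz, h⟩
          push Not at this
          obtain ⟨t', ht', htz', hne⟩ := this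
          exact ⟨t', ⟨ht', hne⟩, htz'⟩
        · exact ⟨t, ⟨ht, htw⟩, htz⟩
      · obtain ⟨u, A, hvu, huw, hA, huA, hwA⟩ := hpair v hwv
        obtain ⟨U, huU, honly, hoff, hex⟩ :=
          hh.exists_exchange hG hW (hnb v hwv).1 hvu hwv.symm huw hA huA hwA
        obtain ⟨hTDS, hcard⟩ := hex B hB
        have hwU : w ∉ U := fun hw => huw (honly w hwv.symm hw).symm
        refine ih _ ?_ _ (hW.isMinTDS_of_ncard_le hB hTDS hcard) (Or.inr ⟨hwB, hwU⟩) rfl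
        rw [← hn]
        refine Set.ncard_lt_ncard ⟨fun v' hv' => ⟨hv'.1, fun t ht htv' => ?_⟩, fun hle => ?_⟩
        · by_cases hvv : v' = v
          · subst hvv
            exact hv t ht htv'
          · exact hv'.2 t (Or.inr ⟨ht, hoff v' t hv'.1 hvv htv'.symm⟩) htv'
        · exact huw ((hle ⟨hwv, hv⟩).2 u (Or.inl ⟨huA, huU⟩) hvu.symm)
  obtain ⟨v, hwv⟩ := hh.exists_adj w
  obtain ⟨_, A, -, -, hA, -, hwA⟩ := hpair v hwv
  exact key _ A hA hwA rfl

lemma eq_of_adj_height_two [Finite V] (hh : IsBalancedHeight G h)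
    (hG : G.IsAcyclic) (hW : WTD G) {p s₁ s₂ : V}
    (h₁ : G.Adj p s₁) (h₂ : G.Adj p s₂) (hs₁ : h s₁ = 1) (hs₂ : h s₂ = 1) : s₁ = s₂ := by
  by_contra hne
  obtain ⟨l₁, hl₁, hl₁'⟩ := hh.exists_lower (v := s₁) (by omega)
  obtain ⟨l₂, hl₂, hl₂'⟩ := hh.exists_lower (v := s₂) (by omega)
  have leaf₁ : ∀ {z}, G.Adj l₁ z → z = s₁ := fun hz => hh.eq_of_leaf (by omega) hz hl₁.symm
  have leaf₂ : ∀ {z}, G.Adj l₂ z → z = s₂ := fun hz => hh.eq_of_leaf (by omega) hz hl₂.symm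
  have hodd := @hh.odd_iff
  have hs₁o : Odd (h s₁) := by simp [hs₁]
  have hs₂o : Odd (h s₂) := by simp [hs₂]
  have hl : l₁ ≠ l₂ := by
    rintro rfl
    exact hne (leaf₂ hl₁.symm)
  obtain ⟨D, hD, hDX⟩ := exists_isMinTDS_disjoint (G := G)
      {z | (G.Adj s₁ z ∨ G.Adj s₂ z) ∧ z ≠ l₁ ∧ z ≠ l₂} fun z => by
    by_contra! hz
    simp only [Set.mem_ofPred_eq] at hz
    have hz₁ : z ≠ s₁ := by
      rintro rfl
      exact (hz l₁ hl₁).2.1 rfl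
    have hz₂ : z ≠ s₂ := by
      rintro rfl
      exact (hz l₂ hl₂).2.2 rfl
    obtain ⟨a, hza⟩ := hh.exists_adj z
    have ha := (hz a hza).1
    have hzodd : Odd (h z) := by grind [G.adj_comm]
    obtain ⟨b, hzb, hba⟩ := hh.exists_adj_ne (by rintro h0; simp [h0] at hzodd) hza
    have hb := (hz b hzb).1
    have key₁ : ∀ {a b}, G.Adj z a → G.Adj z b → b ≠ a → G.Adj s₁ a → G.Adj s₁ b → False :=
      fun hza hzb hba ha hb => hz₁ (hG.eq_of_adj_four hza.symm hzb hb.symm ha hba.symm)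
    have key₂ : ∀ {a b}, G.Adj z a → G.Adj z b → b ≠ a → G.Adj s₂ a → G.Adj s₂ b → False :=
      fun hza hzb hba ha hb => hz₂ (hG.eq_of_adj_four hza.symm hzb hb.symm ha hba.symm)
    have key : ∀ {a b}, G.Adj z a → G.Adj z b → b ≠ a → G.Adj s₁ a → G.Adj s₂ b → False := by
      intro a b hza hzb hba ha hb
      by_cases hap : a = p
      · exact key₂ hza hzb hba (hap ▸ h₂.symm) hb
      by_cases hbp : b = p
      · exact key₁ hza hzb hba ha (hbp ▸ h₁.symm)
      exact hG.false_of_adj_six hza ha.symm h₁.symm h₂ hb hzb.symm hz₁ hap hne (Ne.symm hbp)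
    rcases ha with ha | ha <;> rcases hb with hb | hb
    · exact key₁ hza hzb hba ha hb
    · exact key hza hzb hba ha hb
    · exact key hzb hza hba.symm hb ha
    · exact key₂ hza hzb hba ha hb
  have hl₁D : l₁ ∈ D := by
    obtain ⟨t, ht, hts⟩ := isTDS_iff.1 hD.1 s₁
    by_contra hn
    refine hDX t ht ⟨Or.inl hts.symm, fun h => hn (h ▸ ht), ?_⟩
    rintro rfl
    exact hne (leaf₂ hts)
  have hl₂D : l₂ ∈ D := by
    obtain ⟨t, ht, hts⟩ := isTDS_iff.1 hD.1 s₂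
    by_contra hn
    refine hDX t ht ⟨Or.inr hts.symm, ?_, fun h => hn (h ▸ ht)⟩
    rintro rfl
    exact hne (leaf₁ hts).symm
  have hTDS : IsTDS G (insert p (D \ {l₁, l₂})) := isTDS_iff.2 fun z => by
    obtain ⟨t, ht, htz⟩ := isTDS_iff.1 hD.1 z
    by_cases ht₁ : t = l₁
    · subst ht₁
      exact ⟨p, Or.inl rfl, leaf₁ htz ▸ h₁⟩
    by_cases ht₂ : t = l₂
    · subst ht₂
      exact ⟨p, Or.inl rfl, leaf₂ htz ▸ h₂⟩
    exact ⟨t, Or.inr ⟨ht, by simp [ht₁, ht₂]⟩, htz⟩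
  have hle := hW.ncard_le hD hTDS
  have hins := Set.ncard_insert_le p (D \ {l₁, l₂})
  have hsub : ({l₁, l₂} : Set V) ⊆ D := by
    rintro x (rfl | rfl) <;> assumption
  have hdiff := Set.ncard_sdiff_add_ncard_of_subset hsub
  rw [Set.ncard_pair hl] at hdiff
  omega

lemma eq_of_adj_height_one [Finite V] (hh : IsBalancedHeight G h)
    (hG : G.IsAcyclic) (hW : WTD G) {s p q : V} (hs : h s = 1)
    (hsp : G.Adj s p) (hsq : G.Adj s q) (hp : h p = 2) (hq : h q = 2) : p = q := by
  by_contra hne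
  have hodd : Odd (h s) := by simp [hs]
  obtain ⟨A, hA, hpA, hqA⟩ :=
    hh.exists_isMinTDS_mem_mem hG hodd hsp hsq hne (by omega) (by omega)
  obtain ⟨U, hpU, honly, -, hex⟩ := hh.exists_exchange hG hW hodd hsp hsq hne hA hpA hqA
  obtain ⟨l, hl, hl'⟩ := hh.exists_lower (v := s) (by omega)
  have leaf : ∀ {z}, G.Adj l z → z = s := fun hz => hh.eq_of_leaf (by omega) hz hl.symm
  have hlp : l ≠ p := by
    rintro rfl
    omega
  obtain ⟨B, hB, hBX⟩ := exists_isMinTDS_disjoint (G := G) {z | G.Adj s z ∧ z ≠ l} fun z => by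
    by_contra! hz
    simp only [Set.mem_ofPred_eq] at hz
    have hzs : z ≠ s := by
      rintro rfl
      exact (hz l hl).2 rfl
    obtain ⟨a, hza⟩ := hh.exists_adj z
    have ha := hz a hza
    have hzodd : Odd (h z) := (hh.odd_iff hza).2 ((hh.odd_iff ha.1).1 hodd)
    obtain ⟨b, hzb, hba⟩ := hh.exists_adj_ne (by rintro h0; simp [h0] at hzodd) hza
    exact hzs (hG.eq_of_adj_four hza.symm hzb (hz b hzb).1.symm ha.1 hba.symm)
  have hlB : l ∈ B := by
    obtain ⟨t, ht, hts⟩ := isTDS_iff.1 hB.1 s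
    by_contra hn
    exact hBX t ht ⟨hts.symm, fun h => hn (h ▸ ht)⟩
  obtain ⟨hTDS, hcard⟩ := hex B hB
  refine (hW.isMinTDS_of_ncard_le hB hTDS hcard).2 _
    (Set.sdiff_singleton_ssubset.2 (Or.inr ⟨hlB, fun hlU => hlp (honly l hl hlU)⟩))
    (isTDS_iff.2 fun z => ?_)
  obtain ⟨t, ht, htz⟩ := isTDS_iff.1 hTDS z
  by_cases htl : t = l
  · subst htl
    exact ⟨p, ⟨Or.inl ⟨hpA, hpU⟩, hlp.symm⟩, leaf htz ▸ hsp.symm⟩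
  · exact ⟨t, ⟨ht, htl⟩, htz⟩

/-- A minimal total dominating set consists of all support vertices and exactly one further
neighbor of each of them. -/
lemma ncard_isMinTDS [Finite V] (hh : IsBalancedHeight G h) (h3 : ∀ v, h v ≤ 3)
    (h2 : ∀ {p s₁ s₂}, h p = 2 → G.Adj p s₁ → G.Adj p s₂ → h s₁ = 1 → h s₂ = 1 → s₁ = s₂)
    (h1 : ∀ {s p q}, h s = 1 → G.Adj s p → G.Adj s q → h p = 2 → h q = 2 → p = q)
    {D : Set V} (hD : IsMinTDS G D) : D.ncard = 2 * {s | h s = 1}.ncard := by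
  have hS : ∀ {s}, h s = 1 → s ∈ D := fun hs => hh.support_mem hD.1 hs
  have remove : ∀ {x}, x ∈ D → (∀ z, G.Adj x z → ∃ t ∈ D, t ≠ x ∧ G.Adj t z) → False := by
    intro x hx hxz
    refine hD.2 (D \ {x}) (Set.sdiff_singleton_ssubset.2 hx) (isTDS_iff.2 fun z => ?_)
    obtain ⟨t, ht, htz⟩ := isTDS_iff.1 hD.1 z
    by_cases htx : t = x
    · obtain ⟨t', ht', hne, hadj⟩ := hxz z (htx ▸ htz)
      exact ⟨t', ⟨ht', hne⟩, hadj⟩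
    · exact ⟨t, ⟨ht, htx⟩, htz⟩
  have hlow : ∀ {x}, x ∈ D → h x ≠ 3 := fun {x} hx hx3 => remove hx fun z hxz => by
    have := hh.step hxz
    have := h3 z
    obtain ⟨s, hs, hs'⟩ := hh.exists_lower (v := z) (by omega)
    exact ⟨s, hS (by omega), by rintro rfl; omega, hs.symm⟩
  have leaf_eq : ∀ {x y s}, x ∈ D → y ∈ D → G.Adj x s → G.Adj y s → h x = 0 → x = y := by
    intro x y s hx hy hxs hys hx0
    by_contra hne
    exact remove hx fun z hxz => ⟨y, hy, Ne.symm hne, hh.eq_of_leaf hx0 hxs hxz ▸ hys⟩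
  have uniq : ∀ {x y s}, x ∈ D → y ∈ D → G.Adj x s → G.Adj y s → h s = 1 → x = y := by
    intro x y s hx hy hxs hys hs
    by_cases hx0 : h x = 0
    · exact leaf_eq hx hy hxs hys hx0
    by_cases hy0 : h y = 0
    · exact (leaf_eq hy hx hys hxs hy0).symm
    have := hh.step hxs
    have := hh.step hys
    exact h1 hs hxs.symm hys.symm (by omega) (by omega)
  choose g hgD hgadj using isTDS_iff.1 hD.1
  have hinj : Set.InjOn g {s | h s = 1} := by
    intro s hs t ht hst
    have hs' : h s = 1 := hs
    have ht' : h t = 1 := ht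
    have hsadj := hgadj s
    have htadj := hst ▸ hgadj t
    by_cases h0 : h (g s) = 0
    · exact hh.eq_of_leaf h0 hsadj htadj
    · have := hh.step hsadj
      exact h2 (by omega) hsadj htadj hs' ht'
  have hDeq : D = {s | h s = 1} ∪ g '' {s | h s = 1} := by
    refine Set.Subset.antisymm (fun x hx => ?_) ?_
    · by_cases hx1 : h x = 1
      · exact Or.inl hx1
      obtain ⟨s, hxs, hs⟩ : ∃ s, G.Adj x s ∧ h s = 1 := by
        by_cases hx0 : h x = 0
        · obtain ⟨s, hxs⟩ := hh.exists_adj x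
          have := hh.step hxs
          exact ⟨s, hxs, by omega⟩
        · obtain ⟨s, hxs, hs⟩ := hh.exists_lower hx0
          have := hlow hx
          have := h3 x
          exact ⟨s, hxs, by omega⟩
      exact Or.inr ⟨s, hs, uniq (hgD s) hx (hgadj s) hxs hs⟩
    · rintro x (hx | ⟨s, -, rfl⟩)
      exacts [hS hx, hgD s]
  have hdisj : Disjoint {s | h s = 1} (g '' {s | h s = 1}) := by
    refine Set.disjoint_left.2 ?_
    rintro _ hx ⟨s, hs, rfl⟩
    have hx' : h (g s) = 1 := hx
    have hs' : h s = 1 := hs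
    have := hh.step (hgadj s)
    omega
  rw [hDeq, Set.ncard_union_eq hdisj, hinj.ncard_image, two_mul]

end IsBalancedHeight

lemma heightG_le_iff [Finite V] [Nonempty V] {k : ℕ} :
    heightG G ≤ k ↔ ∀ v, heightV G v ≤ k := by
  have : heightG G = ⨆ v, heightV G v := rfl
  rw [this]
  exact ciSup_le_iff (Set.finite_range _).bddAbove

lemma heightV_le_dist {v l : V} (hl : IsLeaf G l) : heightV G v ≤ G.dist v l :=
  Nat.sInf_le ⟨l, hl, rfl⟩

lemma exists_leaf_dist_eq {l₀ : V} (hl₀ : IsLeaf G l₀) (v : V) :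
    ∃ l, IsLeaf G l ∧ G.dist v l = heightV G v :=
  Nat.sInf_mem (s := {d | ∃ l, IsLeaf G l ∧ G.dist v l = d}) ⟨_, l₀, hl₀, rfl⟩

lemma isBalancedHeight_heightV [Finite V] [Nontrivial V] (hG : G.IsTree) (hbal : IsBalanced G) :
    IsBalancedHeight G (heightV G) := by
  classical
  have := Fintype.ofFinite V
  obtain ⟨l₀, hl₀⟩ := hG.exists_vert_degree_one_of_nontrivial
  have hl₀ : IsLeaf G l₀ := by
    rw [IsLeaf, ← hl₀, ← card_neighborSet_eq_degree, Set.ncard_eq_toFinset_card', Set.toFinset_card]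
  have hle : ∀ {u v}, G.Adj u v → heightV G u ≤ heightV G v + 1 := by
    intro u v huv
    obtain ⟨l, hl, hd⟩ := exists_leaf_dist_eq hl₀ v
    have h1 := hG.connected.dist_triangle (u := u) (v := v) (w := l)
    have h2 := heightV_le_dist (v := u) hl
    rw [dist_eq_one_iff_adj.2 huv] at h1
    omega
  have hstep : ∀ {u v}, G.Adj u v →
      heightV G u = heightV G v + 1 ∨ heightV G v = heightV G u + 1 := by
    intro u v huv
    have h1 := hle huv
    have h2 := hle huv.symm
    have h3 := hbal u v huv
    omega
  refine ⟨hstep, fun {v} hv => ?_, fun {v} => ⟨fun hv => ?_, fun hv => ?_⟩⟩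
  · obtain ⟨l, hl, hd⟩ := exists_leaf_dist_eq hl₀ v
    obtain ⟨p, hp⟩ := hG.connected.exists_walk_length_eq_dist v l
    cases p with
    | nil => simp [← hd] at hv
    | @cons _ u _ hvu q =>
      have h1 := heightV_le_dist (v := u) hl
      have h2 := dist_le q
      have h3 := hstep hvu
      rw [Walk.length_cons] at hp
      exact ⟨u, hvu, by omega⟩
  · obtain ⟨l, hl, hd⟩ := exists_leaf_dist_eq hl₀ v
    rw [hv, hG.connected.dist_eq_zero_iff] at hd
    exact hd ▸ hl
  · have := heightV_le_dist (v := v) hv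
    rw [dist_self] at this
    omega

lemma heightV_eq_zero_of_subsingleton [Subsingleton V] (v : V) : heightV G v = 0 := by
  have : ∀ l, ¬ IsLeaf G l := fun l hl => by
    obtain ⟨u, hu⟩ := Set.ncard_eq_one.1 hl
    have hlu : u ∈ G.neighborSet l := hu ▸ rfl
    exact G.ne_of_adj hlu (Subsingleton.elim _ _)
  simp [heightV, this]

lemma wtd_of_subsingleton [Subsingleton V] [Nonempty V] : WTD G := by
  intro D _ hD _
  obtain ⟨v⟩ := ‹Nonempty V›
  obtain ⟨u, -, huv⟩ := isTDS_iff.1 hD.1 v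
  exact absurd (Subsingleton.elim u v) huv.ne

end TotalDomination

theorem stmt16 {V : Type*} [Fintype V] (T : SimpleGraph V) (htree : T.IsTree)
    (hbal : IsBalanced T) :
    WTD T ↔
      (heightG T ≤ 3 ∧
       (∀ v : V, heightV T v = 2 →
         ({u ∈ T.neighborSet v | heightV T u = 1}).ncard = 1) ∧
       (∀ v : V, heightV T v = 1 →
         ({u ∈ T.neighborSet v | heightV T u = 2}).ncard ≤ 1)) := by
  have := htree.connected.nonempty
  rw [heightG_le_iff]
  rcases subsingleton_or_nontrivial V with hV | hV
  · simp [heightV_eq_zero_of_subsingleton, wtd_of_subsingleton]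
  have hh := isBalancedHeight_heightV htree hbal
  have hacyc := htree.isAcyclic
  refine ⟨fun hW => ⟨fun v => ?_, fun v hv => ?_, fun v hv => ?_⟩, fun ⟨h3, h2, h1⟩ => ?_⟩
  · by_contra! hv
    obtain ⟨w, hw⟩ := hh.exists_height_eq (v := v) (k := 4) hv
    exact hh.height_ne_four hacyc hW w hw
  · obtain ⟨s, hvs, hs⟩ := hh.exists_lower (v := v) (by omega)
    have hs1 : heightV T s = 1 := by omega
    refine Set.ncard_eq_one.2 ⟨s, Set.eq_singleton_iff_unique_mem.2 ⟨⟨hvs, hs1⟩, ?_⟩⟩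
    exact fun t ht => hh.eq_of_adj_height_two hacyc hW ht.1 hvs ht.2 hs1
  · exact (Set.ncard_le_one_iff (Set.toFinite _)).2 fun hp hq =>
      hh.eq_of_adj_height_one hacyc hW hv hp.1 hq.1 hp.2 hq.2
  · have h2' : ∀ {p s₁ s₂}, heightV T p = 2 → T.Adj p s₁ → T.Adj p s₂ → heightV T s₁ = 1 →
        heightV T s₂ = 1 → s₁ = s₂ := fun hp hs₁ hs₂ hs₁' hs₂' =>
      (Set.ncard_le_one_iff (Set.toFinite _)).1 (h2 _ hp).le ⟨hs₁, hs₁'⟩ ⟨hs₂, hs₂'⟩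
    have h1' : ∀ {s p q}, heightV T s = 1 → T.Adj s p → T.Adj s q → heightV T p = 2 →
        heightV T q = 2 → p = q := fun hs hp hq hp' hq' =>
      (Set.ncard_le_one_iff (Set.toFinite _)).1 (h1 _ hs) ⟨hp, hp'⟩ ⟨hq, hq'⟩
    intro D₁ D₂ hD₁ hD₂
    rw [hh.ncard_isMinTDS h3 h2' h1' hD₁, hh.ncard_isMinTDS h3 h2' h1' hD₂]
end
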